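/- Let m > 1 be odd, let i ≥ 1 be an integer with gcd(i, 2m) = 1, let d = 2^{2i} − 2^i + 1, let α be a generator of the multiplicative group GF(2^{2m})^*, and let a ∈ GF(2^{2m})^*. Then the function x ↦ Tr_{2m/m}(a x^d) from GF(2^{2m}) to GF(2^m) is a bent vectorial function (i.e., for every nonzero c ∈ GF(2^m), the Boolean function x ↦ Tr(c a x^d) is bent) if and only if a does not lie in the subgroup of GF(2^{2m})^* generated by α^3. -/

import Mathlib

noncomputable section

/-- The finite field `GF(2^n)` is finite. -/
instance (n : ℕ) : Fintype (GaloisField 2 n) := Fintype.ofFinite _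

/-- The absolute trace map from `GF(2^(2m))` to `GF(2)`. -/
def tr (m : ℕ) (x : GaloisField 2 (2*m)) : ZMod 2 :=
  Algebra.trace (ZMod 2) (GaloisField 2 (2*m)) x

/-- A Boolean function `f : GF(2^(2m)) → GF(2)` is bent if all its Walsh
transform values have absolute value `2^m`. -/
def IsBent (m : ℕ) (f : GaloisField 2 (2*m) → ZMod 2) : Prop :=
  ∀ w : GaloisField 2 (2*m),
    |∑ x : GaloisField 2 (2*m), (-1 : ℤ) ^ ((f x + tr m (w * x)).val)| = 2 ^ m

/-- A tuple `(f 0, …, f (ℓ-1))` of Boolean functions on `GF(2^(2m))` is a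
`(2m, ℓ)` bent vectorial function if every nonzero `GF(2)`-linear combination
of the `f j` is bent. -/
def IsBentVectorial (m ℓ : ℕ) (f : Fin ℓ → GaloisField 2 (2*m) → ZMod 2) : Prop :=
  ∀ a : Fin ℓ → ZMod 2, a ≠ 0 → IsBent m (fun x => ∑ j, a j * f j x)

/-- The binary linear code `C(f 0, …, f (ℓ-1))` of length `2^(2m)` (with
coordinates indexed by `GF(2^(2m))`, a codeword being a function
`GF(2^(2m)) → GF(2)`, i.e. the truth table of a Boolean function), spanned by
the truth tables of the `f j`, the truth tables of the linear functions
`x ↦ tr (w * x)` for all `w`, and the all-one vector. -/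
def code (m ℓ : ℕ) (f : Fin ℓ → GaloisField 2 (2*m) → ZMod 2) :
    Submodule (ZMod 2) (GaloisField 2 (2*m) → ZMod 2) :=
  Submodule.span (ZMod 2)
    (Set.range f ∪ Set.range (fun w => fun x => tr m (w * x)) ∪ {fun _ => (1 : ZMod 2)})

/-- The Hamming weight of a codeword: the number of nonzero coordinates. -/
def wt (m : ℕ) (c : GaloisField 2 (2*m) → ZMod 2) : ℕ :=
  {x | c x ≠ 0}.ncard

/-- The support of a codeword: the set of coordinates where it is nonzero. -/
def supp (m : ℕ) (c : GaloisField 2 (2*m) → ZMod 2) : Set (GaloisField 2 (2*m)) :=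
  {x | c x ≠ 0}

section K18
variable {F : Type*} [Field F]

lemma rmul_apply (f g : F →+* F) (x : F) : (f * g) x = f (g x) := rfl

def TT (σ : F →+* F) (m : ℕ) (k : ZMod m) : F →+* F := σ ^ (2 * k.val)

lemma TT_cast (σ : F →+* F) (m : ℕ) (h : σ ^ (2 * m) = 1) (n : ℕ) :
    TT σ m (n : ZMod m) = σ ^ (2 * n) := by
  unfold TT
  rw [ZMod.val_natCast]
  conv_rhs => rw [← Nat.mod_add_div n m]
  rw [mul_add, pow_add, ← mul_assoc, pow_mul σ (2 * m), h, one_pow, mul_one]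

lemma TT_add (σ : F →+* F) (m : ℕ) [NeZero m] (h : σ ^ (2 * m) = 1) (k l : ZMod m) :
    TT σ m (k + l) = TT σ m k * TT σ m l := by
  have hk := ZMod.natCast_zmod_val k
  have hl := ZMod.natCast_zmod_val l
  rw [← hk, ← hl, ← Nat.cast_add, TT_cast σ m h, TT_cast σ m h, TT_cast σ m h, mul_add, pow_add]

lemma TT_zero (σ : F →+* F) (m : ℕ) : TT σ m 0 = 1 := by
  simp [TT]

lemma TT_add_nat (σ : F →+* F) (m : ℕ) [NeZero m] (h : σ ^ (2 * m) = 1) (k : ZMod m) (s : ℕ)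
    (x : F) : TT σ m (k + (s : ZMod m)) x = TT σ m k ((σ ^ (2 * s)) x) := by
  rw [TT_add σ m h, TT_cast σ m h]; rfl

lemma TT_comm (σ : F →+* F) (m : ℕ) (k : ZMod m) (s : ℕ)
    (x : F) : (σ ^ s) (TT σ m k x) = TT σ m k ((σ ^ s) x) := by
  unfold TT
  rw [← rmul_apply, ← rmul_apply, ← pow_add, ← pow_add, add_comm]

/-- twisted circulant matrix of the operator `∑ c s * σ^(2 s)` -/
def MM (σ : F →+* F) (m : ℕ) (c : ℕ → F) : Matrix (ZMod m) (ZMod m) F :=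
  Matrix.of fun k l => ∑ s ∈ Finset.range 4, if k + (s : ZMod m) = l then TT σ m k (c s) else 0

lemma MM_mulVec (σ : F →+* F) (m : ℕ) [NeZero m] (c : ℕ → F) (v : ZMod m → F) (k : ZMod m) :
    (MM σ m c).mulVec v k = ∑ s ∈ Finset.range 4, TT σ m k (c s) * v (k + (s : ZMod m)) := by
  simp only [Matrix.mulVec, dotProduct, MM, Matrix.of_apply, Finset.sum_mul]
  rw [Finset.sum_comm]
  refine Finset.sum_congr rfl fun s _ => ?_
  simp [ite_mul]

lemma MM_det_zero_of (σ : F →+* F) (m : ℕ) [NeZero m] (h : σ ^ (2 * m) = 1) (c : ℕ → F) (y : F)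
    (hy : y ≠ 0) (hL : ∑ s ∈ Finset.range 4, c s * (σ ^ (2 * s)) y = 0) :
    (MM σ m c).det = 0 := by
  rw [← Matrix.exists_mulVec_eq_zero_iff]
  refine ⟨fun l => TT σ m l y, ?_, ?_⟩
  · intro h0
    have := congrFun h0 0
    simp [TT_zero] at this
    exact hy this
  · funext k
    rw [MM_mulVec]
    simp only [TT_add_nat σ m h, ← map_mul, ← map_sum]
    rw [hL, map_zero]; rfl

lemma exists_of_MM_det_zero (σ : F →+* F) (m : ℕ) [NeZero m] (h : σ ^ (2 * m) = 1)
    (hinj : Function.Injective (TT σ m)) (c : ℕ → F)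
    (hd : (MM σ m c).det = 0) :
    ∃ y : F, y ≠ 0 ∧ ∑ s ∈ Finset.range 4, c s * (σ ^ (2 * s)) y = 0 := by
  rw [← Matrix.exists_mulVec_eq_zero_iff] at hd
  obtain ⟨v, hv, hMv⟩ := hd
  by_contra! hcon
  apply hv
  have hL : ∀ θ : F, ∑ s ∈ Finset.range 4, c s * (σ ^ (2 * s))
      (∑ k : ZMod m, TT σ m k (θ * v (-k))) = 0 := by
    intro θ
    have h1 : ∀ s ∈ Finset.range 4, c s * (σ ^ (2 * s)) (∑ k : ZMod m, TT σ m k (θ * v (-k)))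
        = ∑ k : ZMod m, c s * TT σ m k (θ * v (-k + (s : ZMod m))) := by
      intro s _
      rw [map_sum, Finset.mul_sum]
      rw [← Equiv.sum_comp (Equiv.addRight (s : ZMod m))
        (fun k => c s * TT σ m k (θ * v (-k + (s : ZMod m))))]
      refine Finset.sum_congr rfl fun k _ => ?_
      simp only [Equiv.coe_addRight]
      rw [TT_add_nat σ m h, TT_comm]
      congr 4
      ring_nf
    rw [Finset.sum_congr rfl h1, Finset.sum_comm]
    apply Finset.sum_eq_zero
    intro k _
    have h2 := congrArg (TT σ m k) (congrFun hMv (-k))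
    rw [MM_mulVec] at h2
    simp only [Pi.zero_apply, map_zero, map_sum, map_mul] at h2
    have h3 : ∀ x, TT σ m k (TT σ m (-k) x) = x := by
      intro x
      rw [← rmul_apply, ← TT_add σ m h, add_neg_cancel, TT_zero]; rfl
    simp only [h3] at h2
    simp only [map_mul]
    rw [← mul_zero (TT σ m k θ), ← h2, Finset.mul_sum]
    refine Finset.sum_congr rfl fun s _ => ?_
    ring
  have hz : ∀ θ : F, ∑ k : ZMod m, TT σ m k (θ * v (-k)) = 0 := by
    intro θ
    by_contra hne
    exact hcon _ hne (hL θ)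
  have hli := linearIndependent_monoidHom F F
  have hli2 := hli.comp (fun k : ZMod m => (TT σ m k : F →* F)) (by
    intro a b hab
    apply hinj
    ext x
    exact DFunLike.congr_fun hab x)
  rw [Fintype.linearIndependent_iff] at hli2
  have h4 := hli2 (fun k => TT σ m k (v (-k))) (by
    funext θ
    have := hz θ
    simp only [map_mul] at this
    simp only [Finset.sum_apply, Pi.smul_apply, Function.comp, smul_eq_mul, Pi.zero_apply]
    rw [← this]
    refine Finset.sum_congr rfl fun k _ => ?_
    simp [mul_comm])
  funext l
  have := h4 (-l)
  simpa using this

lemma det_perm_char2 {R n : Type*} [CommRing R] [CharP R 2] [Fintype n] [DecidableEq n]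
    (M : Matrix n n R) (e : Equiv.Perm n) : (M.submatrix id e).det = M.det := by
  rw [Matrix.det_permute']
  rcases Int.units_eq_one_or (Equiv.Perm.sign e) with h | h
  · simp [h]
  · simp [h, CharTwo.neg_eq]

lemma MM_det_fix (σ : F →+* F) [CharP F 2] (m : ℕ) [NeZero m] (h : σ ^ (2 * m) = 1) (c : ℕ → F)
    (h3 : c 3 = (σ ^ 3) (c 0)) (h2 : c 2 = σ (c 1)) :
    σ (MM σ m c).det = (MM σ m c).det := by
  have e2 : (σ ^ 2) (MM σ m c).det = (MM σ m c).det := by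
    rw [RingHom.map_det]
    rw [← Matrix.det_submatrix_equiv_self (Equiv.addRight (1 : ZMod m)) (MM σ m c)]
    congr 1
    ext k l
    simp only [RingHom.mapMatrix_apply, Matrix.map_apply, Matrix.submatrix_apply, MM,
      Matrix.of_apply, Equiv.coe_addRight, map_sum]
    refine Finset.sum_congr rfl fun s _ => ?_
    have : (k + 1 + (s : ZMod m) = l + 1) ↔ (k + (s : ZMod m) = l) := by
      rw [add_right_comm, add_left_inj]
    simp only [this]
    have := TT_add_nat σ m h k 1 (c s)
    simp only [Nat.cast_one] at this
    split_ifs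
    · rw [this, TT_comm]
    · simp
  have e3 : (σ ^ 3) (MM σ m c).det = (MM σ m c).det := by
    rw [RingHom.map_det]
    rw [← det_perm_char2 (MM σ m c) (Equiv.addRight (3 : ZMod m)), ← Matrix.det_transpose]
    congr 1
    ext k l
    simp only [RingHom.mapMatrix_apply, Matrix.map_apply, Matrix.submatrix_apply, MM,
      Matrix.of_apply, Equiv.coe_addRight, map_sum, Matrix.transpose_apply, id]
    rw [← Finset.sum_range_reflect (fun s => if k + (s : ZMod m) = l + 3 then TT σ m k (c s) else 0)]
    refine Finset.sum_congr rfl fun s hs => ?_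
    have hs4 : s < 4 := Finset.mem_range.mp hs
    have key : (σ ^ 3) (c s) = (σ ^ (2 * s)) (c (4 - 1 - s)) := by
      interval_cases s
      · simp [h3]
      · simp [h2]
      · simp [h2]
      · simp [h3]
    have hcond : (k + ((4 - 1 - s : ℕ) : ZMod m) = l + 3) ↔ (l + (s : ZMod m) = k) := by
      have : ((4 - 1 - s : ℕ) : ZMod m) = 3 - s := by
        rw [Nat.cast_sub (by omega)]; norm_num
      rw [this]
      constructor
      · intro hh; linear_combination -hh
      · intro hh; linear_combination -hh
    simp only [hcond]
    split_ifs with hc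
    · rw [← hc, TT_add_nat σ m h, TT_comm, key]
    · simp
  have e4 : (σ ^ 3) (MM σ m c).det = σ ((σ ^ 2) (MM σ m c).det) := by
    rw [← rmul_apply, ← pow_succ']
  rw [e3, e2] at e4
  exact e4.symm

open Polynomial in
/-- polynomial version of `MM` -/
def PM {K : Type*} [Field K] (ι : F →+* K) (σ : F →+* F) (m : ℕ) (c : ℕ → F) :
    Matrix (ZMod m) (ZMod m) K[X] :=
  Matrix.of fun k l => ∑ s ∈ Finset.range 4,
    if k + (s : ZMod m) = l then C (ι (TT σ m k (c s))) * X ^ s else 0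

lemma PM_coeff_zero {K : Type*} [Field K] (ι : F →+* K) (σ : F →+* F) (m : ℕ) [NeZero m]
    (c : ℕ → F) : (PM ι σ m c).det.coeff 0 = ∏ k, ι (TT σ m k (c 0)) := by
  rw [Polynomial.coeff_zero_eq_eval_zero, ← Polynomial.coe_evalRingHom, RingHom.map_det,
    ← Matrix.det_diagonal]
  congr 1
  ext k l
  simp only [PM, RingHom.mapMatrix_apply, Matrix.map_apply, Matrix.of_apply, map_sum,
    Matrix.diagonal_apply]
  rw [Finset.sum_eq_single 0]
  · simp only [Nat.cast_zero, add_zero]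
    split_ifs <;> simp
  · intro s _ hs
    split_ifs <;> simp [hs]
  · simp

lemma PM_entry_natDegree {K : Type*} [Field K] (ι : F →+* K) (σ : F →+* F) (m : ℕ)
    (c : ℕ → F) (k l : ZMod m) : (PM ι σ m c k l).natDegree ≤ 3 := by
  simp only [PM, Matrix.of_apply]
  apply Polynomial.natDegree_sum_le_of_forall_le
  intro s hs
  have hs4 : s < 4 := Finset.mem_range.mp hs
  split_ifs
  · exact (Polynomial.natDegree_C_mul_X_pow_le _ _).trans (by omega)
  · simp

lemma PM_natDegree {K : Type*} [Field K] (ι : F →+* K) (σ : F →+* F) (m : ℕ) [NeZero m]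
    (c : ℕ → F) : (PM ι σ m c).det.natDegree ≤ m * 3 := by
  rw [Matrix.det_apply]
  apply Polynomial.natDegree_sum_le_of_forall_le
  intro p _
  refine (Polynomial.natDegree_smul_le _ _).trans ?_
  refine (Polynomial.natDegree_prod_le _ _).trans ?_
  refine (Finset.sum_le_card_nsmul _ _ 3 fun k _ => PM_entry_natDegree ι σ m c _ _).trans ?_
  simp [ZMod.card]

lemma PM_coeff_top {K : Type*} [Field K] [CharP K 2] (ι : F →+* K) (σ : F →+* F) (m : ℕ) [NeZero m]
    (c : ℕ → F) : (PM ι σ m c).det.coeff (m * 3) = ∏ k, ι (TT σ m k (c 3)) := by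
  have h1 : (PM ι σ m c).det.coeff (m * 3)
      = (Matrix.of fun k l => (PM ι σ m c k l).coeff 3).det := by
    rw [Matrix.det_apply, Matrix.det_apply, Polynomial.finsetSum_coeff]
    refine Finset.sum_congr rfl fun p _ => ?_
    rw [Polynomial.coeff_smul]
    congr 1
    have := Polynomial.coeff_prod_of_natDegree_le (s := (Finset.univ : Finset (ZMod m)))
      (fun k => PM ι σ m c (p k) k) 3 (fun k _ => PM_entry_natDegree ι σ m c _ _)
    rw [Finset.card_univ, ZMod.card] at this
    rw [this]
    rfl
  rw [h1, ← det_perm_char2 _ (Equiv.addRight (3 : ZMod m)), ← Matrix.det_diagonal]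
  congr 1
  ext k l
  simp only [PM, Matrix.submatrix_apply, Matrix.of_apply, Matrix.diagonal_apply,
    Finset.sum_range_succ, Finset.sum_range_zero, id, Equiv.coe_addRight, Polynomial.coeff_add]
  have : ∀ (P : Prop) [Decidable P] (z : K) (s : ℕ),
    (if P then Polynomial.C z * Polynomial.X ^ s else 0 : Polynomial K).coeff 3
      = if P then (if 3 = s then z else 0) else 0 := by
    intro P _ z s
    split_ifs <;> simp_all [Polynomial.coeff_C_mul, Polynomial.coeff_X_pow]
  simp only [this]
  simp

lemma PM_eval {K : Type*} [Field K] (ι : F →+* K) (σ : F →+* F) (m : ℕ) [NeZero m]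
    (hσ : σ ^ (2 * m) = 1) (c c' : ℕ → F) (u h : F) (hh : h ≠ 0) (x : K) (hx : x ≠ 0)
    (hc : ∀ s < 4, c' s = u * c s * ∏ t ∈ Finset.range s, (σ ^ (2 * t)) h)
    (hN : x ^ m = ι (∏ t ∈ Finset.range m, (σ ^ (2 * t)) h)) :
    ι (MM σ m c').det = ι (∏ k, TT σ m k u) * (PM ι σ m c).det.eval x := by
  set f : ℕ → K := fun t => ι ((σ ^ (2 * t)) h) / x with hf
  have hf0 : ∀ t, f t ≠ 0 := by
    intro t
    simp only [hf]
    refine div_ne_zero ?_ hx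
    rw [map_ne_zero, map_ne_zero]; exact hh
  set Ψ : ℕ → K := fun n => ∏ t ∈ Finset.range n, f t with hΨ
  have hΨ0 : ∀ n, Ψ n ≠ 0 := fun n => Finset.prod_ne_zero_iff.mpr fun t _ => hf0 t
  have hper : Function.Periodic Ψ m := by
    intro n
    simp only [hΨ]
    rw [add_comm, Finset.prod_range_add]
    have h1 : ∏ t ∈ Finset.range m, f t = 1 := by
      simp only [hf]
      rw [Finset.prod_div_distrib, Finset.prod_const, Finset.card_range, hN, map_prod, div_self]
      rw [Finset.prod_ne_zero_iff]
      intro t _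
      rw [map_ne_zero, map_ne_zero]; exact hh
    rw [h1, one_mul]
    refine Finset.prod_congr rfl fun t _ => ?_
    simp only [hf]
    rw [mul_add, pow_add, hσ, one_mul]
  set ψ : ZMod m → K := fun k => Ψ k.val with hψ
  have hψs : ∀ (k : ZMod m) (s : ℕ), ψ k * ι (TT σ m k (∏ t ∈ Finset.range s, (σ ^ (2 * t)) h))
      = x ^ s * ψ (k + s) := by
    intro k s
    have h1 : ψ (k + s) = Ψ (k.val + s) := by
      simp only [hψ]
      conv_lhs => rw [← ZMod.natCast_zmod_val k, ← Nat.cast_add, ZMod.val_natCast]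
      exact hper.map_mod_nat _
    rw [h1]
    simp only [hψ, hΨ]
    rw [Finset.prod_range_add, map_prod, map_prod]
    have h2 : ∀ t, ι (TT σ m k ((σ ^ (2 * t)) h)) = x * f (k.val + t) := by
      intro t
      simp only [hf, TT]
      rw [← rmul_apply, ← pow_add, ← mul_add]
      field_simp
    simp only [h2]
    rw [Finset.prod_mul_distrib, Finset.prod_const, Finset.card_range]
    ring
  rw [RingHom.map_det, ← Polynomial.coe_evalRingHom, RingHom.map_det]
  have hM : ι.mapMatrix (MM σ m c') = Matrix.of fun k l => (ι (TT σ m k u) / ψ k) *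
      (Matrix.of (fun k l => ψ l * (Polynomial.evalRingHom x).mapMatrix (PM ι σ m c) k l)) k l := by
    ext k l
    simp only [MM, PM, RingHom.mapMatrix_apply, Matrix.map_apply, Matrix.of_apply, map_sum,
      Finset.mul_sum]
    refine Finset.sum_congr rfl fun s hs => ?_
    split_ifs with hkl
    · rw [hc s (Finset.mem_range.mp hs), ← hkl]
      have := hψs k s
      have h0 : ψ k ≠ 0 := hΨ0 _
      simp only [map_mul, Polynomial.coe_evalRingHom, Polynomial.eval_C,
        Polynomial.eval_pow, Polynomial.eval_X]
      field_simp
      linear_combination (ι (TT σ m k u) * ι (TT σ m k (c s))) * this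
    · simp
  rw [hM, Matrix.det_mul_column, Matrix.det_mul_row, Finset.prod_div_distrib, map_prod]
  have : ∏ k, ψ k ≠ 0 := Finset.prod_ne_zero_iff.mpr fun k _ => hΨ0 _
  field_simp

lemma sum_eval_root {K : Type*} [Field K] [CharP K 2] (m R : ℕ) (hm : 0 < m) (ζ : K)
    (hζ : IsPrimitiveRoot ζ (m * 3)) (hR : m * 3 ∣ R) (hRo : Odd R) (D : Polynomial K)
    (hD : D.natDegree ≤ m * 3) :
    ∑ r ∈ Finset.range R, D.eval (ζ ^ r) = D.coeff 0 + D.coeff (m * 3) := by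
  have hR1 : (R : K) = 1 := by
    obtain ⟨k, rfl⟩ := hRo
    push_cast
    rw [CharTwo.two_eq_zero]; simp
  simp only [Polynomial.eval_eq_sum_range' (Nat.lt_succ_of_le hD)]
  rw [Finset.sum_comm]
  have h1 : ∀ e ∈ Finset.range (m * 3 + 1), ∑ r ∈ Finset.range R, D.coeff e * (ζ ^ r) ^ e
      = D.coeff e * ∑ r ∈ Finset.range R, (ζ ^ e) ^ r := by
    intro e _
    rw [Finset.mul_sum]
    refine Finset.sum_congr rfl fun r _ => ?_
    rw [← pow_mul, ← pow_mul, mul_comm r e]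
  rw [Finset.sum_congr rfl h1, Finset.sum_range_succ]
  congr 1
  · rw [Finset.sum_eq_single 0]
    · simp [hR1]
    · intro e he h0
      have he' := Finset.mem_range.mp he
      have hne : 1 - ζ ^ e ≠ 0 := by
        intro h
        have h2 : ζ ^ e = 1 := (sub_eq_zero.mp h).symm
        rw [hζ.pow_eq_one_iff_dvd] at h2
        exact absurd (Nat.le_of_dvd (Nat.pos_of_ne_zero h0) h2) (by omega)
      have h3 := mul_neg_geom_sum (ζ ^ e) R
      have h4 : (ζ ^ e) ^ R = 1 := by
        rw [← pow_mul, hζ.pow_eq_one_iff_dvd]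
        exact hR.mul_left e
      rw [h4, sub_self] at h3
      rw [(mul_eq_zero.mp h3).resolve_left hne, mul_zero]
    · intro h
      exact absurd (Finset.mem_range.mpr (by omega)) h
  · simp [hζ.pow_eq_one, hR1]

lemma ff_pow4 [Fintype F] (m : ℕ) (hF : Fintype.card F = 2 ^ (2 * m)) (x : F) : x ^ 4 ^ m = x := by
  have := FiniteField.pow_card x
  rw [hF, pow_mul] at this
  exact this

lemma ff_pow4_mod [Fintype F] (m : ℕ) (hF : Fintype.card F = 2 ^ (2 * m)) (x : F) (n : ℕ) :
    x ^ 4 ^ (n % m) = x ^ 4 ^ n := by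
  conv_rhs => rw [← Nat.mod_add_div n m, pow_add, pow_mul]
  generalize n / m = k
  induction k with
  | zero => simp
  | succ k ih => rw [mul_add, pow_add, pow_mul, ← ih, mul_one, ff_pow4 m hF]

/-- the exponent of the norm to `GF(4)` -/
def EE (m : ℕ) : ℕ := ∑ j ∈ Finset.range m, 4 ^ j

lemma EE_eq (m : ℕ) : 3 * EE m + 1 = 4 ^ m := by
  induction m with
  | zero => simp [EE]
  | succ k ih =>
    have : EE (k + 1) = EE k + 4 ^ k := by simp [EE, Finset.sum_range_succ]
    rw [this, pow_succ]; omega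

lemma prod_zmod {M : Type*} [CommMonoid M] (m : ℕ) [NeZero m] (f : ℕ → M) :
    ∏ k : ZMod m, f k.val = ∏ t ∈ Finset.range m, f t := by
  refine Finset.prod_nbij' (fun k => k.val) (fun t => (t : ZMod m)) ?_ ?_ ?_ ?_ ?_
  · intro k _; exact Finset.mem_range.mpr (ZMod.val_lt k)
  · simp
  · simp
  · intro t ht; exact ZMod.val_cast_of_lt (Finset.mem_range.mp ht)
  · simp

variable [CharP F 2]

def sg (F : Type*) [Field F] [CharP F 2] (i : ℕ) : F →+* F := iterateFrobenius F 2 i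

lemma sg_pow (i n : ℕ) (x : F) : (sg F i ^ n) x = x ^ 2 ^ (i * n) := by
  induction n generalizing x with
  | zero => simp
  | succ n ih =>
    rw [pow_succ, rmul_apply, ih, sg, iterateFrobenius_def, ← pow_mul, ← pow_add]
    ring_nf

lemma sg_apply (i : ℕ) (x : F) : sg F i x = x ^ 2 ^ i := by
  have := sg_pow i 1 x
  simpa using this

lemma sg_pow_two (i t : ℕ) (x : F) : (sg F i ^ (2 * t)) x = x ^ 4 ^ (i * t) := by
  rw [sg_pow, show i * (2 * t) = 2 * (i * t) by ring, pow_mul 2]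
  norm_num

lemma sg_order [Fintype F] (m i : ℕ) (hF : Fintype.card F = 2 ^ (2 * m)) :
    sg F i ^ (2 * m) = 1 := by
  ext x
  rw [sg_pow_two, ← ff_pow4_mod m hF]
  simp

lemma norm_TT [Fintype F] (m i : ℕ) [NeZero m] (hF : Fintype.card F = 2 ^ (2 * m))
    (hg : Nat.Coprime i m) (x : F) : ∏ k, TT (sg F i) m k x = x ^ EE m := by
  have h1 : ∀ k : ZMod m, TT (sg F i) m k x
      = (fun k : ZMod m => x ^ 4 ^ k.val) (Units.mulLeft (ZMod.unitOfCoprime i hg) k) := by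
    intro k
    simp only [TT, sg_pow_two, Units.mulLeft_apply, ZMod.coe_unitOfCoprime]
    rw [ZMod.val_mul, ZMod.val_natCast, ff_pow4_mod m hF, ← ff_pow4_mod m hF,
      ← ff_pow4_mod m hF x (i % m * k.val)]
    congr 2
    simp [Nat.mul_mod]
  rw [Finset.prod_congr rfl fun k _ => h1 k, Equiv.prod_comp (Units.mulLeft (ZMod.unitOfCoprime i hg))
    (fun k : ZMod m => x ^ 4 ^ k.val), prod_zmod m (fun t => x ^ 4 ^ t),
    Finset.prod_pow_eq_pow_sum, EE]

lemma norm_range [Fintype F] (m i : ℕ) [NeZero m] (hF : Fintype.card F = 2 ^ (2 * m))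
    (hg : Nat.Coprime i m) (x : F) :
    ∏ t ∈ Finset.range m, (sg F i ^ (2 * t)) x = x ^ EE m := by
  rw [← norm_TT m i hF hg, ← prod_zmod m (fun t => (sg F i ^ (2 * t)) x)]
  rfl

lemma norm_cube [Fintype F] (m : ℕ) (hF : Fintype.card F = 2 ^ (2 * m)) (x : F) (hx : x ≠ 0) :
    (x ^ EE m) ^ 3 = 1 := by
  rw [← pow_mul]
  have h1 := ff_pow4 m hF x
  rw [← EE_eq, pow_succ, mul_comm 3] at h1
  exact mul_right_cancel₀ hx (by rw [h1, one_mul])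

/-- coefficients -/
def cc (σ : F →+* F) (A W : F) (s : ℕ) : F :=
  if s = 0 then A else if s = 1 then (σ ^ 2) W else if s = 2 then (σ ^ 3) W else (σ ^ 3) A

lemma two_pow_odd (i : ℕ) (hi : Odd i) : ∃ k, 2 ^ i = 3 * k + 2 := by
  obtain ⟨j, rfl⟩ := hi
  refine ⟨2 * EE j, ?_⟩
  have := EE_eq j
  rw [pow_succ, pow_mul]
  norm_num
  omega

lemma dd_three (i : ℕ) (hi : Odd i) : 3 ∣ 2 ^ (2 * i) - 2 ^ i + 1 := by
  obtain ⟨k, hk⟩ := two_pow_odd i hi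
  rw [mul_comm 2 i, pow_mul, hk]
  have : (3 * k + 2) ^ 2 - (3 * k + 2) = 9 * k ^ 2 + 9 * k + 2 := by
    rw [Nat.sub_eq_iff_eq_add (by nlinarith)]; ring
  rw [this]
  exact ⟨3 * k ^ 2 + 3 * k + 1, by ring⟩

lemma cc_twist (i : ℕ) (a w g : F) (hg : g ≠ 0) (s : ℕ) (hs : s < 4) :
    cc (sg F i) (a * g ^ (2 ^ (2 * i) - 2 ^ i + 1)) (w * g) s
      = g ^ (2 ^ (2 * i) - 2 ^ i + 1) * cc (sg F i) a w s *
        ∏ t ∈ Finset.range s, (sg F i ^ (2 * t)) (sg F i g / g) := by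
  set σ := sg F i with hσ
  have hd : g ^ (2 ^ (2 * i) - 2 ^ i + 1) = (σ ^ 2) g * g / σ g := by
    rw [eq_div_iff (by rw [map_ne_zero]; exact hg), sg_pow, sg_apply, ← pow_add, ← pow_succ]
    congr 1
    have : 2 ^ i ≤ 2 ^ (2 * i) := Nat.pow_le_pow_right (by norm_num) (by omega)
    rw [mul_comm i 2]; omega
  rw [hd]
  have n1 : ∀ n, (σ ^ n) g ≠ 0 := fun n => by rw [map_ne_zero]; exact hg
  have c1 : ∀ n (x : F), (σ ^ n) (σ x) = (σ ^ (n + 1)) x := fun n x => by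
    rw [pow_succ]; rfl
  have c2 : ∀ n k (x : F), (σ ^ n) ((σ ^ k) x) = (σ ^ (n + k)) x := fun n k x => by
    rw [pow_add]; rfl
  have c0 : σ g = (σ ^ 1) g := by simp
  rw [c0]
  have := n1 1
  have := n1 2
  have := n1 3
  have := n1 4
  have := n1 5
  interval_cases s
  · simp only [cc, if_true, Finset.range_zero, Finset.prod_empty]
    ring
  · simp only [cc, Finset.prod_range_succ, Finset.range_zero, Finset.prod_empty, map_div₀, map_mul, c2]
    norm_num only [if_true, if_false, pow_zero]
    rw [show (1 : F →+* F) g = g from rfl]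
    field_simp
  · simp only [cc, Finset.prod_range_succ, Finset.range_zero, Finset.prod_empty, map_div₀, map_mul, c2]
    norm_num only [if_true, if_false, pow_zero]
    rw [show (1 : F →+* F) g = g from rfl]
    field_simp
  · simp only [cc, Finset.prod_range_succ, Finset.range_zero, Finset.prod_empty, map_div₀, map_mul, c2]
    norm_num only [if_true, if_false, pow_zero]
    rw [show (1 : F →+* F) g = g from rfl]
    field_simp

lemma det_sum [Fintype F] (m i : ℕ) [NeZero m] (hF : Fintype.card F = 2 ^ (2 * m))
    (hmo : Odd m) (hio : Odd i) (hgc : Nat.Coprime i m) (α : F) (hα : α ≠ 0) (hα1 : α ^ EE m ≠ 1)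
    (a w : F) (ha : a ≠ 0) :
    ∑ r ∈ Finset.range (m * (2 ^ (2 * m) - 1)),
      (MM (sg F i) m (cc (sg F i) (a * (α ^ r) ^ (2 ^ (2 * i) - 2 ^ i + 1)) (w * α ^ r))).det
      = a ^ EE m + (a ^ EE m) ^ 2 := by
  have hm0 : 0 < m := Nat.pos_of_ne_zero (NeZero.ne m)
  let K := AlgebraicClosure F
  let ι : F →+* K := algebraMap F K
  have hιinj : Function.Injective ι := ι.injective
  have : CharP K 2 := charP_of_injective_ringHom hιinj 2
  have hcube := norm_cube m hF α hα
  have : NeZero ((m * 3 : ℕ) : K) := ⟨by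
    rw [Ne, CharP.cast_eq_zero_iff K 2, ← even_iff_two_dvd, Nat.not_even_iff_odd]
    exact hmo.mul (by decide)⟩
  obtain ⟨ζ, hζ, hζm⟩ : ∃ ζ : K, IsPrimitiveRoot ζ (m * 3) ∧ ζ ^ m = ι (α ^ EE m) := by
    obtain ⟨ζ, hζ⟩ := HasEnoughRootsOfUnity.exists_primitiveRoot K (m * 3)
    have h3 : IsPrimitiveRoot (ζ ^ m) 3 := hζ.pow (by omega) rfl
    obtain ⟨j, hj, hj2⟩ := h3.eq_pow_of_pow_eq_one (ξ := ι (α ^ EE m))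
      (by rw [← map_pow, hcube, map_one])
    interval_cases j
    · exfalso
      apply hα1
      apply hιinj
      rw [← hj2, map_one, pow_zero]
    · exact ⟨ζ, hζ, by rw [← hj2, pow_one]⟩
    · refine ⟨ζ ^ 2, hζ.pow_of_coprime 2 ?_, ?_⟩
      · rw [Nat.coprime_two_left]; exact hmo.mul (by decide)
      · rw [← hj2, ← pow_mul, ← pow_mul, mul_comm]
  have hζ0 : ζ ≠ 0 := hζ.ne_zero (by omega)
  have hcard : 2 ^ (2 * m) - 1 = 3 * EE m := by
    have := EE_eq m
    rw [pow_mul]; norm_num; omega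
  apply hιinj
  rw [map_sum]
  have hterm : ∀ r ∈ Finset.range (m * (2 ^ (2 * m) - 1)),
      ι (MM (sg F i) m (cc (sg F i) (a * (α ^ r) ^ (2 ^ (2 * i) - 2 ^ i + 1)) (w * α ^ r))).det
      = (PM ι (sg F i) m (cc (sg F i) a w)).det.eval (ζ ^ r) := by
    intro r _
    have hg0 : α ^ r ≠ 0 := pow_ne_zero r hα
    have hgc3 := norm_cube m hF _ hg0
    rw [PM_eval ι (sg F i) m (sg_order m i hF) (cc (sg F i) a w) _
      ((α ^ r) ^ (2 ^ (2 * i) - 2 ^ i + 1)) (sg F i (α ^ r) / α ^ r)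
      (div_ne_zero (by rw [map_ne_zero]; exact hg0) hg0) (ζ ^ r) (pow_ne_zero r hζ0)
      (fun s hs => cc_twist i a w (α ^ r) hg0 s hs) ?_]
    · rw [norm_TT m i hF hgc]
      obtain ⟨k, hk⟩ := dd_three i hio
      rw [hk, ← pow_mul, mul_comm (3 * k), pow_mul (α ^ r), pow_mul _ 3 k, hgc3, one_pow, map_one, one_mul]
    · rw [norm_range m i hF hgc, ← pow_mul, mul_comm r m, pow_mul, hζm, ← map_pow]
      congr 1
      rw [div_pow, sg_apply, eq_div_iff (pow_ne_zero _ hg0)]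
      obtain ⟨k, hk⟩ := two_pow_odd i hio
      rw [← pow_mul (α ^ r), mul_comm (2 ^ i), pow_mul (α ^ r), hk, pow_add, pow_mul _ 3, hgc3,
        one_pow, one_mul, ← pow_mul, mul_comm (EE m) r, pow_mul]
      ring
  rw [Finset.sum_congr rfl hterm, sum_eval_root m _ hm0 ζ hζ _ _ _ (PM_natDegree _ _ _ _),
    PM_coeff_zero, PM_coeff_top, ← map_prod, ← map_prod, norm_TT m i hF hgc, norm_TT m i hF hgc,
    map_add]
  · congr 2
    have : cc (sg F i) a w 3 = (sg F i ^ 3) a := by simp only [cc]; norm_num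
    rw [this, ← map_pow, sg_pow]
    obtain ⟨k, hk⟩ := two_pow_odd (i * 3) (hio.mul (by decide))
    rw [hk, pow_add, pow_mul, norm_cube m hF a ha, one_pow, one_mul]
  · rw [hcard]; exact ⟨EE m, by ring⟩
  · refine hmo.mul ?_
    have : Even (2 ^ (2 * m)) := (Nat.even_pow.mpr ⟨by decide, by omega⟩)
    exact Nat.Even.sub_odd Nat.one_le_two_pow this odd_one

variable [Fintype F] [Algebra (ZMod 2) F]

/-- additive character -/
def chi (x : F) : ℤ := (-1) ^ (Algebra.trace (ZMod 2) F x).val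

lemma chi_add (x y : F) : chi (x + y) = chi x * chi y := by
  unfold chi
  rw [map_add]
  generalize Algebra.trace (ZMod 2) F x = u
  generalize Algebra.trace (ZMod 2) F y = v
  revert u v; decide

lemma chi_zero : chi (0 : F) = 1 := by simp [chi]

lemma chi_mul_self (x : F) : chi x * chi x = 1 := by
  unfold chi
  generalize Algebra.trace (ZMod 2) F x = u
  revert u; decide

lemma chi_cast (x : F) : ((chi x : ℤ) : ZMod 2) = 1 := by
  unfold chi
  generalize Algebra.trace (ZMod 2) F x = u
  revert u; decide

lemma chi_sq (x : F) : chi (x ^ 2) = chi x := by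
  unfold chi
  have h := Algebra.trace_eq_of_algEquiv (FiniteField.frobeniusAlgEquivOfAlgebraic (ZMod 2) F) x
  have h2 : (FiniteField.frobeniusAlgEquivOfAlgebraic (ZMod 2) F) x = x ^ 2 := by
    simp [ZMod.card]
  rw [h2] at h
  rw [h]

lemma chi_pow (x : F) (n : ℕ) : chi (x ^ 2 ^ n) = chi x := by
  induction n with
  | zero => simp
  | succ n ih => rw [pow_succ, pow_mul, chi_sq, ih]

lemma chi_sum_zero (b : F) (hb : b ≠ 0) : ∑ y : F, chi (y * b) = 0 := by
  obtain ⟨c, hc⟩ : ∃ c, Algebra.trace (ZMod 2) F (b * c) ≠ 0 := by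
    by_contra! hcon
    exact hb ((traceForm_nondegenerate (ZMod 2) F).1 b fun y => hcon y)
  have hc1 : chi (c * b) = -1 := by
    unfold chi
    rw [mul_comm c b]
    generalize Algebra.trace (ZMod 2) F (b * c) = u at hc
    revert u; decide
  have h1 : ∑ y : F, chi (y * b) = ∑ y : F, chi ((y + c) * b) :=
    (Equiv.sum_comp (Equiv.addRight c) (fun y => chi (y * b))).symm
  simp only [add_mul, chi_add, hc1] at h1
  rw [← Finset.sum_mul] at h1
  linarith

lemma chi_sum (b : F) [DecidableEq F] :
    ∑ y : F, chi (y * b) = if b = 0 then (Fintype.card F : ℤ) else 0 := by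
  split_ifs with h
  · simp [h, chi_zero]
  · exact chi_sum_zero b h

lemma S_sq (i : ℕ) (A W : F) [DecidableEq F] :
    (∑ y : F, chi (A * y ^ (2 ^ (i * 3) + 1) + W * y ^ (2 ^ i + 1))) ^ 2
     = Fintype.card F * ∑ z : F,
        if ∑ s ∈ Finset.range 4, cc (sg F i) A W s * (sg F i ^ (2 * s)) z = 0 then
          chi (A * z ^ (2 ^ (i * 3) + 1) + W * z ^ (2 ^ i + 1)) else 0 := by
  set Q : F → F := fun y => A * y ^ (2 ^ (i * 3) + 1) + W * y ^ (2 ^ i + 1) with hQ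
  set L : F → F := fun z => ∑ s ∈ Finset.range 4, cc (sg F i) A W s * (sg F i ^ (2 * s)) z with hL
  have key : ∀ y z : F, chi (Q y) * chi (Q (y + z)) = chi (Q z) * chi (y ^ 2 ^ (i * 3) * L z) := by
    intro y z
    have e1 : Q y + Q (y + z) = Q z + (y ^ 2 ^ (i * 3) * (A * z) + A * (y * z ^ 2 ^ (i * 3))
        + W * (y ^ 2 ^ i * z) + W * (y * z ^ 2 ^ i)) := by
      simp only [hQ, pow_succ, add_pow_char_pow]
      linear_combination (A * y ^ 2 ^ (i * 3) * y + W * y ^ 2 ^ i * y) * CharTwo.two_eq_zero (R := F)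
    have e2 : y ^ 2 ^ (i * 3) * L z = y ^ 2 ^ (i * 3) * (A * z)
        + (A * (y * z ^ 2 ^ (i * 3))) ^ 2 ^ (i * 3)
        + (W * (y ^ 2 ^ i * z)) ^ 2 ^ (i * 2) + (W * (y * z ^ 2 ^ i)) ^ 2 ^ (i * 3) := by
      simp only [hL, Finset.sum_range_succ, Finset.sum_range_zero, cc, sg_pow]
      norm_num only [if_true, if_false]
      simp only [mul_pow, ← pow_mul, ← pow_add]
      ring_nf
    rw [← chi_add, e1, e2]
    simp only [chi_add, chi_pow]
  have hbij : Function.Bijective (fun y : F => y ^ 2 ^ (i * 3)) := by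
    have : (fun y : F => y ^ 2 ^ (i * 3)) = (sg F i ^ 3 : F →+* F) := by
      funext y; rw [sg_pow]
    rw [this]
    exact Finite.injective_iff_bijective.mp (RingHom.injective _)
  rw [sq, Finset.sum_mul_sum]
  have h1 : ∀ y ∈ (Finset.univ : Finset F), ∑ z : F, chi (Q y) * chi (Q z)
      = ∑ z : F, chi (Q z) * chi (y ^ 2 ^ (i * 3) * L z) := by
    intro y _
    rw [← Equiv.sum_comp (Equiv.addLeft y) (fun z => chi (Q y) * chi (Q z))]
    exact Finset.sum_congr rfl fun z _ => key y z
  rw [Finset.sum_congr rfl h1, Finset.sum_comm, Finset.mul_sum]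
  refine Finset.sum_congr rfl fun z _ => ?_
  rw [← Finset.mul_sum, hbij.sum_comp (fun y => chi (y * L z)), chi_sum]
  split_ifs <;> ring

lemma sg_fix (m i : ℕ) (hF : Fintype.card F = 2 ^ (2 * m)) (hg : Nat.gcd i (2 * m) = 1) (x : F)
    (hx : sg F i x = x) : x = 0 ∨ x = 1 := by
  have h1 : Function.IsPeriodicPt (frobenius F 2) i x := by
    unfold Function.IsPeriodicPt Function.IsFixedPt
    rw [iterate_frobenius, ← sg_apply, hx]
  have h2 : Function.IsPeriodicPt (frobenius F 2) (2 * m) x := by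
    unfold Function.IsPeriodicPt Function.IsFixedPt
    rw [iterate_frobenius, ← hF, FiniteField.pow_card]
  have h3 := h1.gcd h2
  rw [hg] at h3
  have h4 : x ^ 2 = x := by
    simpa [Function.IsPeriodicPt, Function.IsFixedPt, frobenius_def] using h3
  have h5 : x * (x - 1) = 0 := by linear_combination h4
  rcases mul_eq_zero.mp h5 with h | h
  · exact Or.inl h
  · exact Or.inr (sub_eq_zero.mp h)

lemma TT_inj (m i : ℕ) [NeZero m] (hF : Fintype.card F = 2 ^ (2 * m)) (hgc : Nat.Coprime i m)
    (α : Fˣ) (hα : ∀ z : Fˣ, z ∈ Subgroup.zpowers α) :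
    Function.Injective (TT (sg F i) m) := by
  classical
  have ho : orderOf α = 4 ^ m - 1 := by
    rw [orderOf_eq_card_of_forall_mem_zpowers hα, Nat.card_eq_fintype_card, Fintype.card_units, hF,
      pow_mul]
    norm_num
  have hm0 : 0 < m := Nat.pos_of_ne_zero (NeZero.ne m)
  have hlt : ∀ n, 4 ^ (n % m) < 4 ^ m - 1 := by
    intro n
    have h1 : 4 ^ (n % m + 1) ≤ 4 ^ m := Nat.pow_le_pow_right (by norm_num) (Nat.mod_lt n hm0)
    have h2 : 0 < 4 ^ (n % m) := by positivity
    rw [pow_succ] at h1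
    omega
  intro k l hkl
  have h1 := DFunLike.congr_fun hkl (α : F)
  simp only [TT, sg_pow_two] at h1
  rw [← ff_pow4_mod m hF, ← ff_pow4_mod m hF _ (i * l.val)] at h1
  have h2 : α ^ 4 ^ (i * k.val % m) = α ^ 4 ^ (i * l.val % m) := by
    ext; simpa using h1
  have h3 := pow_injOn_Iio_orderOf (by simpa [ho] using hlt _) (by simpa [ho] using hlt _) h2
  have h4 : i * k.val % m = i * l.val % m := Nat.pow_right_injective (by norm_num) h3
  have h5 : k.val ≡ l.val [MOD m] := Nat.ModEq.cancel_left_of_coprime (by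
    rw [Nat.gcd_comm]; exact hgc) h4
  have h6 := (ZMod.natCast_eq_natCast_iff _ _ _).mpr h5
  simpa using h6

lemma S_val (m i : ℕ) [NeZero m] (hF : Fintype.card F = 2 ^ (2 * m)) (hg : Nat.gcd i (2 * m) = 1)
    (hinj : Function.Injective (TT (sg F i) m)) (A W : F) :
    ∃ u : ℤ, ∑ y : F, chi (A * y ^ (2 ^ (i * 3) + 1) + W * y ^ (2 ^ i + 1)) = 2 ^ m * u ∧
      (u : F) = (MM (sg F i) m (cc (sg F i) A W)).det := by
  classical
  have hS := S_sq i A W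
  have hord := sg_order (F := F) m i hF
  rw [hF] at hS
  have hfix := MM_det_fix (sg F i) m hord (cc (sg F i) A W) (by simp only [cc]; norm_num)
    (by simp only [cc]; norm_num)
  set S := ∑ y : F, chi (A * y ^ (2 ^ (i * 3) + 1) + W * y ^ (2 ^ i + 1)) with hSd
  rcases sg_fix m i hF hg _ hfix with h0 | h1
  · obtain ⟨y0, hy0, hLy⟩ := exists_of_MM_det_zero (sg F i) m hord hinj _ h0
    rw [h0]
    set T := ∑ z : F,
        if ∑ s ∈ Finset.range 4, cc (sg F i) A W s * (sg F i ^ (2 * s)) z = 0 then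
          chi (A * z ^ (2 ^ (i * 3) + 1) + W * z ^ (2 ^ i + 1)) else 0 with hT
    have hTe : (T : ZMod 2) = 0 := by
      rw [hT, Int.cast_sum]
      refine Finset.sum_involution (fun z _ => z + y0) ?_ ?_ ?_ ?_
      · intro z _
        have : ∑ s ∈ Finset.range 4, cc (sg F i) A W s * (sg F i ^ (2 * s)) (z + y0)
            = ∑ s ∈ Finset.range 4, cc (sg F i) A W s * (sg F i ^ (2 * s)) z := by
          simp only [map_add, mul_add, Finset.sum_add_distrib, hLy, add_zero]
        rw [this]
        split_ifs
        · rw [chi_cast, chi_cast]; decide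
        · simp
      · intro z _ _ h
        exact hy0 (by simpa using h)
      · intros; simp
      · intro z _
        rw [add_assoc, CharTwo.add_self_eq_zero, add_zero]
    have hd : (2 ^ m : ℤ) ∣ S := by
      rw [← Int.pow_dvd_pow_iff (n := 2) (by norm_num), hS]
      refine Dvd.intro T ?_
      push_cast
      ring
    obtain ⟨u, hu⟩ := hd
    refine ⟨u, hu, ?_⟩
    have h2 : u ^ 2 = T := by
      have : (2 ^ m : ℤ) ^ 2 * u ^ 2 = (2 ^ m) ^ 2 * T := by
        rw [← mul_pow, ← hu, hS]; push_cast; ring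
      exact mul_left_cancel₀ (by positivity) this
    have h3 : ((u : ZMod 2)) ^ 2 = 0 := by rw [← Int.cast_pow, h2, hTe]
    have h4 : (u : ZMod 2) = 0 := by simpa using h3
    rw [CharP.intCast_eq_zero_iff (ZMod 2) 2] at h4
    rw [CharP.intCast_eq_zero_iff F 2]
    exact h4
  · have hker : ∀ z : F,
        (∑ s ∈ Finset.range 4, cc (sg F i) A W s * (sg F i ^ (2 * s)) z = 0) ↔ z = 0 := by
      intro z
      constructor
      · intro hz
        by_contra hne
        have := MM_det_zero_of (sg F i) m hord _ z hne hz
        rw [this] at h1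
        exact zero_ne_one h1
      · rintro rfl
        simp
    simp only [hker] at hS
    rw [Finset.sum_ite_eq' Finset.univ (0 : F)] at hS
    simp [chi_zero] at hS
    rw [h1]
    have : (S - 2 ^ m) * (S + 2 ^ m) = 0 := by
      have : (2 : ℤ) ^ (2 * m) = 2 ^ m * 2 ^ m := by ring
      linear_combination hS + this
    rcases mul_eq_zero.mp this with h | h
    · exact ⟨1, by linear_combination h, by simp⟩
    · exact ⟨-1, by linear_combination h, by simp [CharTwo.neg_eq]⟩

lemma sum_units [DecidableEq F] (f : F → ℤ) : ∑ x : F, f x = f 0 + ∑ u : Fˣ, f u := by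
  rw [Fintype.sum_eq_add_sum_compl 0]
  congr 1
  symm
  refine Finset.sum_bij (fun u _ => (u : F)) ?_ ?_ ?_ ?_
  · simp
  · intro x _ y _ h; exact Units.ext h
  · intro x hx
    exact ⟨Units.mk0 x (by simpa using hx), Finset.mem_univ _, rfl⟩
  · simp

lemma sum_gen [DecidableEq F] (m N : ℕ) (hN : Fintype.card F = N + 1) (α : Fˣ)
    (hα : ∀ z : Fˣ, z ∈ Subgroup.zpowers α) (f : F → ℤ) :
    ∑ r ∈ Finset.range (m * N), f ((α : F) ^ r) = m * ∑ u : Fˣ, f u := by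
  have hc : Nat.card Fˣ = N := by
    rw [Nat.card_eq_fintype_card, Fintype.card_units, hN]; rfl
  have h1 : ∑ r ∈ Finset.range N, f ((α : F) ^ r) = ∑ u : Fˣ, f u := by
    rw [← IsCyclic.image_range_card hα, hc, Finset.sum_image]
    · simp
    · intro x hx y hy hxy
      have ho : orderOf α = N := by rw [orderOf_eq_card_of_forall_mem_zpowers hα, hc]
      apply pow_injOn_Iio_orderOf _ _ hxy
      · simpa [ho] using hx
      · simpa [ho] using hy
  induction m with
  | zero => simp
  | succ k ih =>
    rw [add_mul, one_mul, Finset.sum_range_add, ih, ← h1]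
    have h2 : α ^ (k * N) = 1 := by
      rw [mul_comm, pow_mul, ← hc, pow_card_eq_one', one_pow]
    have h3 : (α : F) ^ (k * N) = 1 := by rw [← Units.val_pow_eq_pow_val, h2, Units.val_one]
    simp only [pow_add, h3, one_mul]
    push_cast
    ring

lemma walsh_val (m i : ℕ) [NeZero m] (hF : Fintype.card F = 2 ^ (2 * m)) (hmo : Odd m)
    (hg : Nat.gcd i (2 * m) = 1) (α : Fˣ) (hα : ∀ z : Fˣ, z ∈ Subgroup.zpowers α)
    (hα1 : (α : F) ^ EE m ≠ 1) (a w : F) (ha : a ≠ 0) :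
    ∃ v : ℤ, ∑ x : F, chi (a * x ^ (2 ^ (2 * i) - 2 ^ i + 1) + w * x) = 2 ^ m * v ∧
      (v : F) = a ^ EE m + (a ^ EE m) ^ 2 := by
  classical
  have hgc : Nat.Coprime i m := Nat.Coprime.coprime_mul_left_right (k := 2) hg
  have hio : Odd i := by
    have : Nat.Coprime i 2 := Nat.Coprime.coprime_mul_right_right (k := m) hg
    exact Nat.coprime_two_right.mp this
  have hinj := TT_inj m i hF hgc α hα
  set d := 2 ^ (2 * i) - 2 ^ i + 1 with hd
  set f : F → ℤ := fun x => chi (a * x ^ d + w * x) with hf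
  set N := 2 ^ (2 * m) - 1 with hN
  have hN1 : Fintype.card F = N + 1 := by
    have := Nat.one_le_two_pow (n := 2 * m)
    rw [hF]; omega
  have hdq : (2 ^ i + 1) * d = 2 ^ (i * 3) + 1 := by
    obtain ⟨e, he⟩ : ∃ e, 2 ^ (2 * i) = 2 ^ i + e :=
      Nat.exists_eq_add_of_le (Nat.pow_le_pow_right (by norm_num) (by omega))
    have h3 : d = e + 1 := by omega
    have h2 : 2 ^ (2 * i) = 2 ^ i * 2 ^ i := by ring
    have h4 : 2 ^ (i * 3) = 2 ^ (2 * i) * 2 ^ i := by ring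
    rw [h3, h4, he]
    rw [he] at h2
    nlinarith
  have hSf : ∀ g : F, ∑ y : F, chi ((a * g ^ d) * y ^ (2 ^ (i * 3) + 1) + (w * g) * y ^ (2 ^ i + 1))
      = ∑ y : F, f (g * y ^ (2 ^ i + 1)) := by
    intro g
    refine Finset.sum_congr rfl fun y _ => ?_
    simp only [hf]
    rw [mul_pow, ← pow_mul, hdq]
    congr 1
    ring
  choose u hu1 hu2 using fun r : ℕ =>
    S_val m i hF hg hinj (a * ((α : F) ^ r) ^ d) (w * (α : F) ^ r)
  have hsum : ∑ r ∈ Finset.range (m * N), ∑ y : F, f ((α : F) ^ r * y ^ (2 ^ i + 1))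
      = ((m * N : ℕ) : ℤ) * ∑ x : F, f x := by
    rw [Finset.sum_comm, sum_units, sum_units f]
    have h0 : ∑ r ∈ Finset.range (m * N), f ((α : F) ^ r * 0 ^ (2 ^ i + 1))
        = ((m * N : ℕ) : ℤ) * f 0 := by
      simp
    have h1 : ∀ y ∈ (Finset.univ : Finset Fˣ),
        ∑ r ∈ Finset.range (m * N), f ((α : F) ^ r * (y : F) ^ (2 ^ i + 1))
        = m * ∑ z : Fˣ, f z := by
      intro y _
      rw [sum_gen m N hN1 α hα (fun z => f (z * (y : F) ^ (2 ^ i + 1)))]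
      congr 1
      rw [← Equiv.sum_comp (Equiv.mulRight (y ^ (2 ^ i + 1))) (fun z : Fˣ => f z)]
      simp
    rw [h0, Finset.sum_congr rfl h1, Finset.sum_const, Finset.card_univ, Fintype.card_units, hN1]
    push_cast
    simp
    ring
  have hoddR : Odd (m * N) := by
    refine hmo.mul ?_
    have : Even (2 ^ (2 * m)) := (Nat.even_pow.mpr ⟨by decide, by have := NeZero.ne m; omega⟩)
    exact Nat.Even.sub_odd Nat.one_le_two_pow this odd_one
  have heq : ((m * N : ℕ) : ℤ) * ∑ x : F, f x = 2 ^ m * ∑ r ∈ Finset.range (m * N), u r := by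
    rw [← hsum, Finset.mul_sum]
    refine Finset.sum_congr rfl fun r _ => ?_
    rw [← hSf, hu1]
  have hdvd : (2 ^ m : ℤ) ∣ ∑ x : F, f x := by
    have hcop : IsCoprime (2 ^ m : ℤ) ((m * N : ℕ) : ℤ) := by
      apply IsCoprime.pow_left
      have := (Nat.coprime_two_left.mpr hoddR)
      exact_mod_cast Nat.isCoprime_iff_coprime.mpr this
    exact hcop.dvd_of_dvd_mul_left ⟨_, heq⟩
  obtain ⟨v, hv⟩ := hdvd
  refine ⟨v, hv, ?_⟩
  rw [← det_sum m i hF hmo hio hgc α (Units.ne_zero α) hα1 a w ha]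
  rw [hv] at heq
  have h5 : ((m * N : ℕ) : ℤ) * v = ∑ r ∈ Finset.range (m * N), u r := by
    have : (2 ^ m : ℤ) ≠ 0 := by positivity
    apply mul_left_cancel₀ this
    linear_combination heq
  have h6 := congrArg (Int.cast : ℤ → F) h5
  have hR1 : ((m * N : ℕ) : F) = 1 := by
    obtain ⟨k, hk⟩ := hoddR
    rw [hk]
    push_cast
    rw [CharTwo.two_eq_zero]; simp
  rw [Int.cast_mul, Int.cast_natCast, hR1, one_mul, Int.cast_sum] at h6
  rw [h6]
  exact Finset.sum_congr rfl fun r _ => hu2 r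

lemma int_cast_odd (v : ℤ) (hv : v = 1 ∨ v = -1) : (v : F) = 1 := by
  rcases hv with rfl | rfl
  · simp
  · simp [CharTwo.neg_eq]

lemma parseval (f : F → ℤ) (hf : ∀ x, f x * f x = 1) :
    ∑ w : F, (∑ x : F, f x * chi (w * x)) ^ 2 = (Fintype.card F : ℤ) * Fintype.card F := by
  classical
  have h1 : ∀ w : F, (∑ x : F, f x * chi (w * x)) ^ 2
      = ∑ x : F, ∑ y : F, f x * f y * chi (w * (x + y)) := by
    intro w
    rw [sq, Finset.sum_mul_sum]
    refine Finset.sum_congr rfl fun x _ => Finset.sum_congr rfl fun y _ => ?_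
    rw [mul_add, chi_add]; ring
  simp only [h1]
  rw [Finset.sum_comm]
  have h2 : ∀ x ∈ (Finset.univ : Finset F), ∑ w : F, ∑ y : F, f x * f y * chi (w * (x + y))
      = Fintype.card F := by
    intro x _
    rw [Finset.sum_comm]
    simp only [← Finset.mul_sum, chi_sum]
    rw [Finset.sum_eq_single x]
    · rw [CharTwo.add_self_eq_zero, hf]; simp
    · intro y _ hy
      rw [if_neg, mul_zero]
      intro h
      exact hy (CharTwo.add_eq_zero.mp h).symm
    · simp
  rw [Finset.sum_congr rfl h2]
  simp

lemma bent_of_odd (m : ℕ) (hF : Fintype.card F = 2 ^ (2 * m)) (f : F → F)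
    (h : ∀ w : F, ∃ v : ℤ, ∑ x : F, chi (f x + w * x) = 2 ^ m * v ∧ (v : F) = 1) (w : F) :
    |∑ x : F, chi (f x + w * x)| = 2 ^ m := by
  have hp := parseval (fun x => chi (f x)) (fun x => chi_mul_self _)
  simp only [← chi_add] at hp
  have hge : ∀ w ∈ (Finset.univ : Finset F),
      ((2 : ℤ) ^ m) ^ 2 ≤ (∑ x : F, chi (f x + w * x)) ^ 2 := by
    intro w _
    obtain ⟨v, hv, hv1⟩ := h w
    rw [hv, mul_pow]
    have hv0 : v ≠ 0 := by rintro rfl; simp at hv1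
    have : 1 ≤ v ^ 2 := by
      have := sq_pos_of_ne_zero hv0
      omega
    nlinarith [sq_nonneg ((2 : ℤ) ^ m)]
  have hsum : ∑ _w : F, ((2 : ℤ) ^ m) ^ 2 = ∑ w : F, (∑ x : F, chi (f x + w * x)) ^ 2 := by
    rw [hp, Finset.sum_const, Finset.card_univ, hF]
    push_cast
    rw [nsmul_eq_mul]
    push_cast
    ring
  have := (Finset.sum_eq_sum_iff_of_le hge).mp hsum w (Finset.mem_univ w)
  rw [← sq_eq_sq₀ (abs_nonneg _) (by positivity), sq_abs]
  exact this.symm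

end K18

lemma GF_card (m : ℕ) (hm : 1 < m) : Fintype.card (GaloisField 2 (2 * m)) = 2 ^ (2 * m) := by
  rw [← Nat.card_eq_fintype_card]
  exact GaloisField.card 2 (2 * m) (by omega)

/-- for odd `m > 1`, `gcd(i, 2m) = 1`, `d = 2^(2i) - 2^i + 1`,
a generator `α` of `GF(2^(2m))^*` and `a ∈ GF(2^(2m))^*`, the function
`x ↦ Tr_{2m/m}(a x^d)` is a bent vectorial function (i.e.
`x ↦ tr (c * a * x^d)` is bent for every nonzero `c` in the subfield
`GF(2^m)`) iff `a ∉ ⟨α^3⟩`. -/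
theorem stmt_18 (m i : ℕ) (hm : 1 < m) (hmodd : Odd m) (hi : 1 ≤ i)
    (hgcd : Nat.gcd i (2*m) = 1)
    (α : (GaloisField 2 (2*m))ˣ)
    (hα : ∀ z : (GaloisField 2 (2*m))ˣ, z ∈ Subgroup.zpowers α)
    (a : (GaloisField 2 (2*m))ˣ) :
    (∀ c : GaloisField 2 (2*m), c ≠ 0 → c ^ (2^m) = c →
        IsBent m (fun x =>
          tr m (c * (a : GaloisField 2 (2*m)) * x ^ (2^(2*i) - 2^i + 1)))) ↔
      a ∉ Subgroup.zpowers (α ^ 3) := by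
  have : NeZero m := ⟨by omega⟩
  have hF := GF_card m hm
  have ho : orderOf α = 3 * EE m := by
    classical
    rw [orderOf_eq_card_of_forall_mem_zpowers hα, Nat.card_eq_fintype_card, Fintype.card_units, hF,
      pow_mul]
    have := EE_eq m
    norm_num
    omega
  have hE0 : 0 < EE m := by
    have h1 := EE_eq m
    have h2 : 4 ^ 1 ≤ 4 ^ m := Nat.pow_le_pow_right (by norm_num) (by omega)
    omega
  have hα1 : (α : GaloisField 2 (2*m)) ^ EE m ≠ 1 := by
    intro h
    have h1 : α ^ EE m = 1 := by ext; simpa using h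
    have h2 := orderOf_dvd_of_pow_eq_one h1
    rw [ho] at h2
    have := Nat.le_of_dvd hE0 h2
    omega
  have hW := fun b w hb => walsh_val m i hF hmodd hgcd α hα hα1 b w hb
  constructor
  · intro hbent hmem
    obtain ⟨z, hz⟩ := Subgroup.mem_zpowers_iff.mp hmem
    have haE : (a : GaloisField 2 (2*m)) ^ EE m = 1 := by
      have : a ^ EE m = 1 := by
        rw [← hz, ← zpow_natCast, ← zpow_mul, mul_comm z, zpow_mul, zpow_natCast, ← pow_mul, ← ho,
          pow_orderOf_eq_one, one_zpow]
      rw [← Units.val_pow_eq_pow_val, this, Units.val_one]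
    have hb := hbent 1 one_ne_zero (one_pow _) 0
    obtain ⟨v, hv, hv1⟩ := hW a 0 (Units.ne_zero a)
    rw [haE, one_pow, CharTwo.add_self_eq_zero] at hv1
    have hb2 : |∑ x : GaloisField 2 (2*m),
        chi ((a : GaloisField 2 (2*m)) * x ^ (2 ^ (2 * i) - 2 ^ i + 1) + 0 * x)| = 2 ^ m := by
      rw [← hb]
      congr 1
      refine Finset.sum_congr rfl fun x _ => ?_
      unfold chi tr
      rw [map_add, one_mul]
    rw [hv, abs_mul, abs_of_pos (by positivity)] at hb2
    have hv2 : |v| = 1 := by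
      have h2 : (2 : ℤ) ^ m ≠ 0 := by positivity
      apply mul_left_cancel₀ h2
      rw [hb2, mul_one]
    have hv3 := int_cast_odd (F := GaloisField 2 (2*m)) v (by
      rcases abs_cases v with h | h
      · left; omega
      · right; omega)
    rw [hv1] at hv3
    exact zero_ne_one hv3
  · intro hnot c hc0 hc w
    have hcE : c ^ EE m = 1 := by
      obtain ⟨k, hk⟩ := two_pow_odd m hmodd
      have h1 : c ^ (2 ^ m - 1) = 1 := by
        apply mul_right_cancel₀ hc0
        rw [← pow_succ, Nat.sub_add_cancel Nat.one_le_two_pow, hc, one_mul]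
      have h2 : EE m = (2 ^ m - 1) * (k + 1) := by
        have h3 := EE_eq m
        have h4 : 4 ^ m = 2 ^ m * 2 ^ m := by rw [← mul_pow]; norm_num
        rw [hk] at h4
        have h5 : 2 ^ m - 1 = 3 * k + 1 := by omega
        rw [h5]
        nlinarith
      rw [h2, pow_mul, h1, one_pow]
    have haE : (a : GaloisField 2 (2*m)) ^ EE m ≠ 1 := by
      intro h
      have h1 : a ^ EE m = 1 := by ext; simpa using h
      obtain ⟨z, hz⟩ := Subgroup.mem_zpowers_iff.mp (hα a)
      rw [← hz, ← zpow_natCast, ← zpow_mul, ← orderOf_dvd_iff_zpow_eq_one, ho] at h1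
      push_cast at h1
      have h2 : (3 : ℤ) ∣ z := by
        have h3 : (EE m : ℤ) ≠ 0 := by exact_mod_cast hE0.ne'
        exact (mul_dvd_mul_iff_right h3).mp h1
      obtain ⟨y, rfl⟩ := h2
      apply hnot
      refine Subgroup.mem_zpowers_iff.mpr ⟨y, ?_⟩
      rw [← hz, zpow_mul]
      rfl
    have hb0 : c * (a : GaloisField 2 (2*m)) ≠ 0 := mul_ne_zero hc0 (Units.ne_zero a)
    have hsum1 : (c * (a : GaloisField 2 (2*m))) ^ EE m
        + ((c * (a : GaloisField 2 (2*m))) ^ EE m) ^ 2 = 1 := by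
      have h3 := norm_cube m hF _ hb0
      have hne : (c * (a : GaloisField 2 (2*m))) ^ EE m ≠ 1 := by
        rw [mul_pow, hcE, one_mul]; exact haE
      generalize (c * (a : GaloisField 2 (2*m))) ^ EE m = t at h3 hne
      have h4 : (t - 1) * (t + t ^ 2 + 1) = 0 := by linear_combination h3
      have h5 := (mul_eq_zero.mp h4).resolve_left (sub_ne_zero.mpr hne)
      exact CharTwo.add_eq_zero.mp h5
    have := bent_of_odd m hF
      (fun x => c * (a : GaloisField 2 (2*m)) * x ^ (2 ^ (2 * i) - 2 ^ i + 1)) (fun w => by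
        obtain ⟨v, hv, hv1⟩ := hW _ w hb0
        exact ⟨v, hv, hv1.trans hsum1⟩) w
    rw [← this]
    congr 1
    refine Finset.sum_congr rfl fun x _ => ?_
    unfold chi tr
    rw [map_add]
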